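/- For the 6-state 2-symbol Turing machine M with transition table δ(A,0)=(1,R,B), δ(A,1)=(0,L,B), δ(B,0)=(0,R,C), δ(B,1)=(1,L,B), δ(C,0)=(1,R,D), δ(C,1)=(0,L,A), δ(D,0)=(1,L,E), δ(D,1)=(1,L,F), δ(E,0)=(1,L,A), δ(E,1)=(0,L,D), δ(F,0)=(1,R,H), δ(F,1)=(1,L,E), and for every natural number n: started from any configuration C(n), the machine eventually halts. -/

import Mathlib

/-- Move direction of the tape head. -/
inductive Dir : Type
  | L
  | R

/-- The head displacement of a direction. -/
def Dir.move : Dir → ℤ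
  | Dir.L => -1
  | Dir.R => 1

/-- A Turing machine with `n` states and `k` symbols, in Rado's busy beaver model.
States are `Fin n` (state `A` is `0`, `B` is `1`, ...), symbols are `Fin k` with `0`
the blank symbol. A transition yields the written symbol, the move direction and the
next state, where `none` denotes the halting state `H`. -/
abbrev Machine (n k : ℕ) : Type :=
  Fin n → Fin k → Fin k × Dir × Option (Fin n)

/-- A configuration: current state (`none` = halted), head position, tape. -/
structure Cfg (n k : ℕ) where
  state : Option (Fin n)
  pos : ℤ
  tape : ℤ → Fin k

/-- One computation step (halted configurations are fixed). -/
def step {n k : ℕ} (M : Machine n k) (c : Cfg n k) : Cfg n k :=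
  match c.state with
  | none => c
  | some q =>
      { state := (M q (c.tape c.pos)).2.2
        pos := c.pos + (M q (c.tape c.pos)).2.1.move
        tape := Function.update c.tape c.pos (M q (c.tape c.pos)).1 }

/-- The initial configuration: state `A`, head at cell `0`, all-blank tape. -/
def init (n k : ℕ) [NeZero k] : Cfg n k :=
  { state := if h : 0 < n then some ⟨0, h⟩ else none
    pos := 0
    tape := fun _ => 0 }

/-- `HaltsIn M c t`: started from `c`, the machine `M` halts after exactly `t` steps. -/
def HaltsIn {n k : ℕ} (M : Machine n k) (c : Cfg n k) (t : ℕ) : Prop :=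
  ((step M)^[t] c).state = none ∧ ∀ i < t, ((step M)^[i] c).state ≠ none

/-- The number of non-blank cells of a configuration. -/
noncomputable def sigmaCount {n k : ℕ} [NeZero k] (c : Cfg n k) : ℕ :=
  Set.ncard {i : ℤ | c.tape i ≠ 0}

/-- Marxen and Buntrock's second 6-state 2-symbol machine
(states `A,B,C,D,E,F` are `0,1,2,3,4,5`; `none` is the halting state `H`). -/
def M : Machine 6 2 :=
  ![![(1, Dir.R, some 1), (0, Dir.L, some 1)],
    ![(0, Dir.R, some 2), (1, Dir.L, some 1)],
    ![(1, Dir.R, some 3), (0, Dir.L, some 0)],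
    ![(1, Dir.L, some 4), (1, Dir.L, some 5)],
    ![(1, Dir.L, some 0), (0, Dir.L, some 3)],
    ![(1, Dir.R, none), (1, Dir.L, some 4)]]

/-- The configuration `C(n)` with head at cell `p`: state `B`, scanned cell blank,
the `n` cells immediately to the left of the head all contain `1`, all other cells blank. -/
def Cf (n : ℕ) (p : ℤ) : Cfg 6 2 :=
  { state := some 1
    pos := p
    tape := fun i => if p - n ≤ i ∧ i < p then 1 else 0 }

open Stream' (cons const)

/-- The machine with `L` to the left of the head (nearest cell first) and `R` from the head
rightwards, the head being at cell `p`. -/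
def tapeCfg (q : Option (Fin 6)) (L R : Stream' (Fin 2)) (p : ℤ) : Cfg 6 2 :=
  { state := q
    pos := p
    tape := fun i => if i < p then L.get (p - 1 - i).toNat else R.get (i - p).toNat }

theorem step_tapeCfg_right {q : Fin 6} {a b : Fin 2} {q' : Option (Fin 6)}
    (h : M q a = (b, Dir.R, q')) (L R : Stream' (Fin 2)) (p : ℤ) :
    step M (tapeCfg (some q) L (cons a R) p) = tapeCfg q' (cons b L) R (p + 1) := by
  simp only [step, tapeCfg, lt_irrefl, if_false, sub_self, Int.toNat_zero, Stream'.get_zero_cons,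
    h, Dir.move, Cfg.mk.injEq, true_and]
  funext i
  rcases lt_trichotomy i p with hi | rfl | hi
  · obtain ⟨k, rfl⟩ : ∃ k : ℕ, i = p - 1 - k := ⟨(p - 1 - i).toNat, by omega⟩
    rw [Function.update_of_ne (by omega), if_pos hi, if_pos (by omega),
      show (p + 1 - 1 - (p - 1 - (k : ℤ))).toNat = k + 1 by omega, Stream'.get_succ_cons,
      show (p - 1 - (p - 1 - (k : ℤ))).toNat = k by omega]
  · rw [Function.update_self, if_pos (by omega), show (i + 1 - 1 - i).toNat = 0 by omega,
      Stream'.get_zero_cons]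
  · obtain ⟨k, rfl⟩ : ∃ k : ℕ, i = p + 1 + k := ⟨(i - p - 1).toNat, by omega⟩
    rw [Function.update_of_ne (by omega), if_neg (by omega), if_neg (by omega),
      show (p + 1 + (k : ℤ) - p).toNat = k + 1 by omega, Stream'.get_succ_cons,
      show (p + 1 + (k : ℤ) - (p + 1)).toNat = k by omega]

theorem step_tapeCfg_left {q : Fin 6} {a b : Fin 2} {q' : Option (Fin 6)}
    (h : M q a = (b, Dir.L, q')) (x : Fin 2) (L R : Stream' (Fin 2)) (p : ℤ) :
    step M (tapeCfg (some q) (cons x L) (cons a R) p) =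
      tapeCfg q' L (cons x (cons b R)) (p - 1) := by
  simp only [step, tapeCfg, lt_irrefl, if_false, sub_self, Int.toNat_zero, Stream'.get_zero_cons,
    h, Dir.move, Cfg.mk.injEq, true_and]
  refine ⟨rfl, ?_⟩
  funext i
  rcases lt_trichotomy i p with hi | rfl | hi
  · rw [Function.update_of_ne (by omega), if_pos hi]
    by_cases h' : i = p - 1
    · subst h'
      rw [if_neg (by omega), show (p - 1 - (p - 1)).toNat = 0 by omega, Stream'.get_zero_cons,
        Stream'.get_zero_cons]
    · obtain ⟨k, rfl⟩ : ∃ k : ℕ, i = p - 2 - k := ⟨(p - 2 - i).toNat, by omega⟩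
      rw [if_pos (by omega), show (p - 1 - (p - 2 - (k : ℤ))).toNat = k + 1 by omega,
        Stream'.get_succ_cons, show (p - 1 - 1 - (p - 2 - (k : ℤ))).toNat = k by omega]
  · rw [Function.update_self, if_neg (by omega), show (i - (i - 1)).toNat = 0 + 1 by omega,
      Stream'.get_succ_cons, Stream'.get_zero_cons]
  · obtain ⟨k, rfl⟩ : ∃ k : ℕ, i = p + 1 + k := ⟨(i - p - 1).toNat, by omega⟩
    rw [Function.update_of_ne (by omega), if_neg (by omega), if_neg (by omega),
      show (p + 1 + (k : ℤ) - p).toNat = k + 1 by omega, Stream'.get_succ_cons,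
      show (p + 1 + (k : ℤ) - (p - 1)).toNat = k + 1 + 1 by omega, Stream'.get_succ_cons,
      Stream'.get_succ_cons]

/-- The machine halts from the given state and half-tapes, wherever the head is. -/
def Halts (q : Option (Fin 6)) (L R : Stream' (Fin 2)) : Prop :=
  ∀ p : ℤ, ∃ t : ℕ, ((step M)^[t] (tapeCfg q L R p)).state = none

theorem halts_none (L R : Stream' (Fin 2)) : Halts none L R := fun _ => ⟨0, rfl⟩

theorem halts_of_right {q : Fin 6} {a b : Fin 2} {q' : Option (Fin 6)}
    (h : M q a = (b, Dir.R, q')) {L R : Stream' (Fin 2)} (H : Halts q' (cons b L) R) :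
    Halts (some q) L (cons a R) := by
  intro p
  obtain ⟨t, ht⟩ := H (p + 1)
  exact ⟨t + 1, by rwa [Function.iterate_succ_apply, step_tapeCfg_right h]⟩

theorem halts_of_left {q : Fin 6} {a b : Fin 2} {q' : Option (Fin 6)}
    (h : M q a = (b, Dir.L, q')) {x : Fin 2} {L R : Stream' (Fin 2)}
    (H : Halts q' L (cons x (cons b R))) : Halts (some q) (cons x L) (cons a R) := by
  intro p
  obtain ⟨t, ht⟩ := H (p - 1)
  exact ⟨t + 1, by rwa [Function.iterate_succ_apply, step_tapeCfg_left h]⟩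

section Transitions

variable {x : Fin 2} {L R : Stream' (Fin 2)}

theorem halts_A0 : Halts (some 1) (cons 1 L) R → Halts (some 0) L (cons 0 R) :=
  halts_of_right rfl

theorem halts_A1 :
    Halts (some 1) L (cons x (cons 0 R)) → Halts (some 0) (cons x L) (cons 1 R) :=
  halts_of_left rfl

theorem halts_B0 : Halts (some 2) (cons 0 L) R → Halts (some 1) L (cons 0 R) :=
  halts_of_right rfl

theorem halts_B1 :
    Halts (some 1) L (cons x (cons 1 R)) → Halts (some 1) (cons x L) (cons 1 R) :=
  halts_of_left rfl

theorem halts_C0 : Halts (some 3) (cons 1 L) R → Halts (some 2) L (cons 0 R) :=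
  halts_of_right rfl

theorem halts_C1 :
    Halts (some 0) L (cons x (cons 0 R)) → Halts (some 2) (cons x L) (cons 1 R) :=
  halts_of_left rfl

theorem halts_D0 :
    Halts (some 4) L (cons x (cons 1 R)) → Halts (some 3) (cons x L) (cons 0 R) :=
  halts_of_left rfl

theorem halts_D1 :
    Halts (some 5) L (cons x (cons 1 R)) → Halts (some 3) (cons x L) (cons 1 R) :=
  halts_of_left rfl

theorem halts_E0 :
    Halts (some 0) L (cons x (cons 1 R)) → Halts (some 4) (cons x L) (cons 0 R) :=
  halts_of_left rfl

theorem halts_E1 :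
    Halts (some 3) L (cons x (cons 0 R)) → Halts (some 4) (cons x L) (cons 1 R) :=
  halts_of_left rfl

theorem halts_F0 : Halts (some 5) L (cons 0 R) :=
  halts_of_right rfl (halts_none _ _)

theorem halts_F1 :
    Halts (some 4) L (cons x (cons 1 R)) → Halts (some 5) (cons x L) (cons 1 R) :=
  halts_of_left rfl

end Transitions

/-- The blank half-tape. -/
abbrev blank : Stream' (Fin 2) := const 0

theorem blank_eq : blank = cons 0 blank := Stream'.const_eq 0

/-- Prepend `n` ones to a half-tape. -/
abbrev ones (n : ℕ) (s : Stream' (Fin 2)) : Stream' (Fin 2) := (cons 1)^[n] s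

theorem ones_succ (n : ℕ) (s : Stream' (Fin 2)) : ones (n + 1) s = cons 1 (ones n s) :=
  Function.iterate_succ_apply' _ _ _

theorem ones_succ' (n : ℕ) (s : Stream' (Fin 2)) : ones (n + 1) s = ones n (cons 1 s) :=
  Function.iterate_succ_apply _ _ _

/-- Prepend `k` copies of the word `110` to a half-tape. -/
abbrev blocks (k : ℕ) (s : Stream' (Fin 2)) : Stream' (Fin 2) :=
  (fun u => cons 1 (cons 1 (cons 0 u)))^[k] s

/-- State `B` scanning the blank to the left of `1 ^ m 0 W`, on a blank left half-tape. -/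
def HaltsSweep (m : ℕ) (W : Stream' (Fin 2)) : Prop :=
  Halts (some 1) blank (cons 0 (ones m (cons 0 W)))

/-- The machine halts from `C(n)`. -/
def HaltsC (n : ℕ) : Prop := Halts (some 1) (ones n blank) blank

theorem halts_B_right {m : ℕ} : ∀ {L R : Stream' (Fin 2)},
    Halts (some 1) (ones m L) (cons 0 R) → Halts (some 1) L (cons 0 (ones m R)) := by
  induction m with
  | zero => exact fun h => h
  | succ m ih =>
    intro L R h
    rw [ones_succ'] at h
    rw [ones_succ]
    exact halts_B0 (halts_C1 (halts_A0 (ih h)))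

theorem halts_B_left {m : ℕ} : ∀ {x : Fin 2} {L R : Stream' (Fin 2)},
    Halts (some 1) L (cons x (ones (m + 1) R)) →
      Halts (some 1) (ones m (cons x L)) (cons 1 R) := by
  induction m with
  | zero => exact fun h => halts_B1 h
  | succ m ih =>
    intro x L R h
    rw [ones_succ]
    refine halts_B1 (ih ?_)
    rwa [← ones_succ']

theorem halts_A_left {m : ℕ} {R : Stream' (Fin 2)}
    (h : HaltsSweep m R) : Halts (some 0) (ones m blank) (cons 1 R) := by
  unfold HaltsSweep at h
  rw [blank_eq]
  cases m with
  | zero => exact halts_A1 h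
  | succ m =>
    rw [ones_succ]
    exact halts_A1 (halts_B_left h)

theorem haltsSweep_succ {m : ℕ} {R : Stream' (Fin 2)}
    (h : HaltsSweep m (ones 3 R)) : HaltsSweep (m + 1) (cons 1 R) := by
  refine halts_B_right (halts_B0 (halts_C0 (halts_D1 (halts_F1 ?_))))
  rw [ones_succ]
  exact halts_E0 (halts_A_left h)

theorem halts_E0_blank {R : Stream' (Fin 2)}
    (h : Halts (some 1) blank (cons 0 (cons 1 (cons 1 R)))) :
    Halts (some 4) blank (cons 0 R) := by
  rw [blank_eq]
  refine halts_E0 (halts_A0 (halts_B1 ?_))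
  rw [blank_eq]
  exact halts_B1 h

theorem haltsSweep_zero {R : Stream' (Fin 2)}
    (h : Halts (some 1) blank (cons 0 (ones 4 R))) : HaltsSweep 0 (cons 1 R) := by
  exact halts_B0 (halts_C0 (halts_D1 (halts_F1 (halts_E0_blank h))))

theorem haltsSweep_ones {m : ℕ} : ∀ {b : ℕ} {W : Stream' (Fin 2)},
    HaltsSweep (2 * m + b + 4) W → HaltsSweep m (ones (b + 1) (cons 0 W)) := by
  induction m with
  | zero =>
    intro b W h
    rw [ones_succ]
    refine haltsSweep_zero ?_
    rw [ones, ← Function.iterate_add_apply, show 4 + b = 2 * 0 + b + 4 by omega]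
    exact h
  | succ m ih =>
    intro b W h
    rw [ones_succ]
    refine haltsSweep_succ ?_
    rw [ones, ← Function.iterate_add_apply, show 3 + b = b + 2 + 1 by omega]
    refine ih ?_
    convert h using 1
    omega

theorem haltsSweep_blocks {k : ℕ} : ∀ {m : ℕ} {W : Stream' (Fin 2)},
    HaltsSweep ((m + 5) * 2 ^ k - 5) W → HaltsSweep m (blocks k W) := by
  induction k with
  | zero =>
    intro m W h
    rwa [pow_zero, mul_one, Nat.add_sub_cancel] at h
  | succ k ih =>
    intro m W h
    rw [blocks, Function.iterate_succ_apply']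
    refine haltsSweep_ones (b := 1) (ih ?_)
    convert h using 2
    ring

theorem haltsSweep_blank {m : ℕ} (h : HaltsC m) : HaltsSweep m blank := by
  refine halts_B_right ?_
  rw [← blank_eq, ← blank_eq]
  exact h

theorem haltsSweep_tail {m k : ℕ} (h : HaltsC ((m + 5) * 2 ^ (k + 2) - 8)) :
    HaltsSweep m (blocks k (cons 1 (cons 0 (cons 1 blank)))) := by
  refine haltsSweep_blocks (haltsSweep_ones (b := 0) ?_)
  rw [blank_eq]
  refine haltsSweep_ones (b := 0) (haltsSweep_blank ?_)
  have : 5 ≤ (m + 5) * 2 ^ k :=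
    (Nat.le_add_left 5 m).trans (Nat.le_mul_of_pos_right _ (by positivity))
  convert h using 1
  rw [pow_add, ← mul_assoc]
  omega

theorem halts_E_blocks {k : ℕ} : ∀ {L R : Stream' (Fin 2)},
    Halts (some 4) L (cons 1 (blocks k R)) →
      Halts (some 4) (ones (3 * k) L) (cons 1 R) := by
  induction k with
  | zero => exact fun h => h
  | succ k ih =>
    intro L R h
    rw [blocks, Function.iterate_succ_apply] at h
    rw [Nat.mul_succ, ones_succ, ones_succ, ones_succ]
    exact halts_E1 (halts_D1 (halts_F1 (ih h)))

theorem haltsC_of_D {n : ℕ} (h : Halts (some 3) (ones n blank)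
    (cons 0 (cons 0 (cons 1 blank)))) : HaltsC n := by
  unfold HaltsC
  nth_rw 2 [blank_eq]
  refine halts_B0 ?_
  nth_rw 2 [blank_eq]
  refine halts_C0 ?_
  nth_rw 2 [blank_eq]
  exact halts_D0 (halts_E1 h)

theorem haltsC_of_E {s k : ℕ} (h : Halts (some 4) (ones s blank)
    (cons 1 (blocks k (cons 1 (cons 0 (cons 1 blank)))))) : HaltsC (3 * k + s + 1) := by
  refine haltsC_of_D ?_
  rw [ones_succ]
  refine halts_D0 ?_
  rw [ones, Function.iterate_add_apply]
  exact halts_E_blocks h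

theorem haltsC_three_mul_add_two (k : ℕ) : HaltsC (3 * k + 2) := by
  refine haltsC_of_E (s := 1) (halts_E1 ?_)
  rw [blank_eq]
  exact halts_D1 halts_F0

theorem haltsC_three_mul_add_one {k : ℕ} (h : HaltsC (2 ^ (k + 5) - 8)) :
    HaltsC (3 * k + 1) := by
  refine haltsC_of_E (s := 0) ?_
  rw [show ones 0 blank = cons 0 (cons 0 blank) by rw [← blank_eq, ← blank_eq]; rfl]
  refine halts_E1 (halts_D0 (halts_E0_blank ?_))
  exact haltsSweep_tail (m := 3) (by convert h using 2; ring)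

theorem haltsC_three_mul {k : ℕ} (h : HaltsC (9 * 2 ^ (k + 1) - 8)) : HaltsC (3 * k) := by
  cases k with
  | zero =>
    refine haltsC_of_D ?_
    rw [show ones (3 * 0) blank = cons 0 blank by rw [← blank_eq]; rfl]
    refine halts_D0 (halts_E0_blank ?_)
    change HaltsSweep 3 (cons 1 blank)
    rw [blank_eq]
    exact haltsSweep_ones (b := 0) (haltsSweep_blank h)
  | succ k =>
    refine haltsC_of_E (s := 2) ?_
    rw [show ones 2 blank = cons 1 (cons 1 (cons 0 blank)) by rw [← blank_eq]; rfl]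
    refine halts_E1 (halts_D1 (halts_F1 (halts_E0_blank ?_)))
    exact haltsSweep_tail (m := 4) h

theorem haltsC_three_mul_add_one_of_odd {k : ℕ} (hk : Odd k) : HaltsC (3 * k + 1) := by
  refine haltsC_three_mul_add_one ?_
  obtain ⟨j, rfl⟩ := hk
  have h4 : 4 ^ j % 3 = 1 := by simp [Nat.pow_mod]
  have h : 2 ^ (2 * j + 1 + 5) = 64 * 4 ^ j := by
    rw [show 2 * j + 1 + 5 = 2 * j + 6 by ring, pow_add, pow_mul]; ring
  rw [h, show 64 * 4 ^ j - 8 = 3 * ((64 * 4 ^ j - 8) / 3) + 2 by omega]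
  exact haltsC_three_mul_add_two _

theorem haltsC_of_dvd (k : ℕ) : HaltsC (3 * k) := by
  refine haltsC_three_mul ?_
  have h : 1 ≤ 2 ^ k := Nat.one_le_two_pow
  rw [show 9 * 2 ^ (k + 1) - 8 = 3 * (2 * (3 * 2 ^ k - 2) + 1) + 1 by rw [pow_succ]; omega]
  exact haltsC_three_mul_add_one_of_odd ⟨_, rfl⟩

theorem haltsC (n : ℕ) : HaltsC n := by
  obtain ⟨k, rfl | rfl | rfl⟩ : ∃ k, n = 3 * k ∨ n = 3 * k + 1 ∨ n = 3 * k + 2 :=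
    ⟨n / 3, by omega⟩
  · exact haltsC_of_dvd k
  · rcases Nat.even_or_odd k with hk | hk
    · refine haltsC_three_mul_add_one ?_
      obtain ⟨j, rfl⟩ := hk
      have h4 : 4 ^ j % 3 = 1 := by simp [Nat.pow_mod]
      have h : 2 ^ (j + j + 5) = 32 * 4 ^ j := by
        rw [← two_mul, pow_add, pow_mul]; ring
      rw [h, show 32 * 4 ^ j - 8 = 3 * ((32 * 4 ^ j - 8) / 3) by omega]
      exact haltsC_of_dvd _
    · exact haltsC_three_mul_add_one_of_odd hk
  · exact haltsC_three_mul_add_two k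

theorem get_ones_blank (n i : ℕ) : (ones n blank).get i = if i < n then 1 else 0 := by
  induction n generalizing i with
  | zero => rfl
  | succ n ih =>
    rw [ones_succ]
    cases i with
    | zero => simp [Stream'.get_zero_cons]
    | succ i => simp [Stream'.get_succ_cons, ih]

theorem Cf_eq_tapeCfg (n : ℕ) (p : ℤ) : Cf n p = tapeCfg (some 1) (ones n blank) blank p := by
  simp only [Cf, tapeCfg, Cfg.mk.injEq, true_and]
  funext i
  rw [get_ones_blank, Stream'.get_const]
  split_ifs <;> first | rfl | omega

/-- From every configuration `C(n)`, Marxen and Buntrock's second machine eventually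
halts. -/
theorem marxen_buntrock_second_always_halts (n : ℕ) (p : ℤ) :
    ∃ t : ℕ, HaltsIn M (Cf n p) t := by
  have h : ∃ t : ℕ, ((step M)^[t] (Cf n p)).state = none := by
    rw [Cf_eq_tapeCfg]
    exact haltsC n p
  classical exact ⟨Nat.find h, Nat.find_spec h, fun _ hi => Nat.find_min h hi⟩
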